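/- Every non-degenerate financial system all of whose external assets and notionals are rational and which satisfies the dedicated CDS debtor property admits at least one clearing vector all of whose coordinates are rational. -/

import Mathlib

open Finset

/-- The liability of bank `i` to bank `j` under recovery-rate vector `r`. -/
def liab {n : ℕ} (c : Fin n → Fin n → ℝ) (cds : Fin n → Fin n → Fin n → ℝ)
    (r : Fin n → ℝ) (i j : Fin n) : ℝ :=
  c i j + ∑ R : Fin n, (1 - r R) * cds i j R

/-- The total liability of bank `i` under recovery-rate vector `r`. -/
def totLiab {n : ℕ} (c : Fin n → Fin n → ℝ) (cds : Fin n → Fin n → Fin n → ℝ)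
    (r : Fin n → ℝ) (i : Fin n) : ℝ :=
  ∑ j : Fin n, liab c cds r i j

/-- The assets of bank `i` under recovery-rate vector `r`
(external assets plus incoming payments `p j i r = r j * liab c cds r j i`). -/
def assets {n : ℕ} (e : Fin n → ℝ) (c : Fin n → Fin n → ℝ)
    (cds : Fin n → Fin n → Fin n → ℝ) (r : Fin n → ℝ) (i : Fin n) : ℝ :=
  e i + ∑ j : Fin n, r j * liab c cds r j i

/-- `r` is a clearing recovery-rate vector. -/
def IsClearing {n : ℕ} (e : Fin n → ℝ) (c : Fin n → Fin n → ℝ)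
    (cds : Fin n → Fin n → Fin n → ℝ) (r : Fin n → ℝ) : Prop :=
  (∀ i, 0 ≤ r i ∧ r i ≤ 1) ∧
  ∀ i, (0 < totLiab c cds r i →
          r i = min 1 (assets e c cds r i / totLiab c cds r i)) ∧
       (totLiab c cds r i = 0 → r i = 1)

/-- `(e, c, cds)` is a financial system. -/
def IsFinSys {n : ℕ} (e : Fin n → ℝ) (c : Fin n → Fin n → ℝ)
    (cds : Fin n → Fin n → Fin n → ℝ) : Prop :=
  (∀ i, 0 ≤ e i) ∧ (∀ i j, 0 ≤ c i j) ∧ (∀ i, c i i = 0) ∧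
  (∀ i j R, 0 ≤ cds i j R) ∧
  (∀ i j R, ¬(i ≠ j ∧ i ≠ R ∧ j ≠ R) → cds i j R = 0)

/-- Blue arc `(u,v)` of the auxiliary graph: there is a debt contract from `u` to `v`. -/
def BlueArc {n : ℕ} (c : Fin n → Fin n → ℝ) (u v : Fin n) : Prop := 0 < c u v

/-- Orange arc `(u,v)` of the auxiliary graph: there is a CDS with debtor `u`, creditor `v`. -/
def OrangeArc {n : ℕ} (cds : Fin n → Fin n → Fin n → ℝ) (u v : Fin n) : Prop :=
  ∃ R, 0 < cds u v R

/-- Red arc `(u,v)` of the auxiliary graph: `v` is the debtor of a CDS whose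
reference bank is `u`. -/
def RedArc {n : ℕ} (cds : Fin n → Fin n → Fin n → ℝ) (u v : Fin n) : Prop :=
  ∃ j, 0 < cds v j u

/-- Colours of arcs of the auxiliary graph. -/
inductive ArcColor : Type
  | blue | orange | red

/-- `HasArc c cds col u v`: the auxiliary graph has an arc `(u,v)` of colour `col`. -/
def HasArc {n : ℕ} (c : Fin n → Fin n → ℝ) (cds : Fin n → Fin n → Fin n → ℝ) :
    ArcColor → Fin n → Fin n → Prop
  | ArcColor.blue => BlueArc c
  | ArcColor.orange => OrangeArc cds
  | ArcColor.red => RedArc cds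

/-- A bank `v` is switched on iff it has more than one incoming red arc, or exactly one
incoming red arc together with at least one outgoing blue arc (equivalently: at least one
incoming red arc and an outgoing blue arc). -/
def SwitchedOn {n : ℕ} (c : Fin n → Fin n → ℝ) (cds : Fin n → Fin n → Fin n → ℝ)
    (v : Fin n) : Prop :=
  (∃ u₁ u₂, u₁ ≠ u₂ ∧ RedArc cds u₁ v ∧ RedArc cds u₂ v) ∨
  ((∃ u, RedArc cds u v) ∧ ∃ w, BlueArc c v w)

/-- Non-degeneracy of a financial system. -/
def NonDegenerate {n : ℕ} (e : Fin n → ℝ) (c : Fin n → Fin n → ℝ)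
    (cds : Fin n → Fin n → Fin n → ℝ) : Prop :=
  (∀ i, (∃ j R, 0 < cds i j R) → (0 < e i ∨ ∃ j, 0 < c i j)) ∧
  (∀ R, (∃ i j, 0 < cds i j R) → ∃ j, 0 < c R j)

/-- The dedicated CDS debtor property: every bank that is the debtor of some CDS with
positive notional has no outgoing debt contract with positive notional, and all its
CDSes with positive notional share the same reference bank. -/
def DedicatedCDSDebtor {n : ℕ} (c : Fin n → Fin n → ℝ)
    (cds : Fin n → Fin n → Fin n → ℝ) : Prop :=
  ∀ i : Fin n, (∃ j R, 0 < cds i j R) →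
    (∀ j, c i j = 0) ∧
    (∀ j R j' R', 0 < cds i j R → 0 < cds i j' R' → R = R')

/-- A surjection between finite sets whose sizes differ by one identifies exactly one pair. -/
theorem exists_pair_of_card_eq_succ {α β : Type*} [DecidableEq α] [DecidableEq β]
    (s : Finset α) (g : α → β) (h : #s = #(s.image g) + 1) :
    ∃ a ∈ s, ∃ b ∈ s, a ≠ b ∧ g a = g b ∧
      ∀ j ∈ s, ((s.erase j).image g = s.image g ↔ j = a ∨ j = b) := by
  obtain ⟨a, ha, b, hb, hab, hg⟩ := exists_ne_map_eq_of_card_lt_of_maps_to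
    (s := s) (t := s.image g) (f := g) (by omega) (fun x hx => mem_image_of_mem g hx)
  refine ⟨a, ha, b, hb, hab, hg, fun j hj => ⟨fun hi => ?_, ?_⟩⟩
  · by_contra! hne
    have hinj : Set.InjOn g (s.erase j) := by
      rw [← card_image_iff, hi, card_erase_of_mem hj]
      omega
    exact hab (hinj (by simp [ha, hne.1.symm]) (by simp [hb, hne.2.symm]) hg)
  · have key : ∀ p ∈ s, ∀ q ∈ s, p ≠ q → g p = g q →
        (s.erase p).image g = s.image g := by
      intro p hp q hq hpq hgpq
      refine (image_subset_image (erase_subset _ _)).antisymm fun y hy => ?_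
      obtain ⟨x, hx, rfl⟩ := mem_image.1 hy
      by_cases hxp : x = p
      · exact mem_image.2 ⟨q, by simp [hq, hpq.symm], by rw [hxp, hgpq]⟩
      · exact mem_image_of_mem g (by simp [hx, hxp])
    rintro (rfl | rfl)
    · exact key _ ha _ hb hab hg
    · exact key _ hb _ ha hab.symm hg.symm

/-- A finite set `σ` is dominant for a family of criteria when every element is weakly
below all of `σ` in some criterion. -/
def Dominant {X I K : Type*} [LE K] (f : I → X → K) (σ : Finset X) : Prop :=
  ∀ y, ∃ i, ∀ x ∈ σ, f i y ≤ f i x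

theorem Dominant.mono {X I K : Type*} [LE K] {f : I → X → K} {σ τ : Finset X}
    (hσ : Dominant f σ) (h : τ ⊆ σ) : Dominant f τ :=
  fun y => (hσ y).imp fun _ hi x hx => hi x (h hx)

section Scarf

variable {T I K : Type*} [Fintype T] [Fintype I] [DecidableEq T] [DecidableEq I] [LinearOrder K]
  {f : I → T ⊕ I → K}

/-- Criterion `i` ranks the slack element `i` strictly lowest and every other slack element above
all non-slack elements. -/
structure IsSlackRanking (f : I → T ⊕ I → K) : Prop where
  injective : ∀ i, Function.Injective (f i)
  slack_le : ∀ i x, f i (Sum.inr i) ≤ f i x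
  lt_slack : ∀ i j t, i ≠ j → f i (Sum.inl t) < f i (Sum.inr j)

/-- The face spanned by all slack elements but one extends to exactly one dominant set. -/
theorem IsSlackRanking.existsUnique_dominant_insert [Nonempty T] (hf : IsSlackRanking f) (i₀ : I) :
    ∃! x, x ∉ (univ.erase i₀).map (Function.Embedding.inr (α := T)) ∧
      Dominant f (insert x ((univ.erase i₀).map Function.Embedding.inr)) := by
  classical
  set τ := (univ.erase i₀).map (Function.Embedding.inr (α := T)) with hτ
  have hmem : ∀ x, x ∈ τ ↔ ∃ i, i ≠ i₀ ∧ x = Sum.inr i := by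
    intro x
    simp only [hτ, mem_map, mem_erase, mem_univ, and_true, Function.Embedding.inr_apply]
    exact exists_congr fun i => and_congr_right fun _ => eq_comm
  obtain ⟨x, hx, hmax⟩ := exists_max_image (univ \ τ) (f i₀)
    ⟨Sum.inr i₀, by simp [hmem]⟩
  have hxτ : x ∉ τ := by simpa using hx
  refine ⟨x, ⟨hxτ, fun y => ?_⟩, ?_⟩
  · by_cases hy : y ∈ τ
    · obtain ⟨i, -, rfl⟩ := (hmem y).1 hy
      exact ⟨i, fun z _ => hf.slack_le i z⟩
    · refine ⟨i₀, fun z hz => ?_⟩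
      rcases mem_insert.1 hz with rfl | hz
      · exact hmax y (by simp [hy])
      · obtain ⟨i, hi, rfl⟩ := (hmem z).1 hz
        rcases y with t | j
        · exact (hf.lt_slack i₀ i t hi.symm).le
        · have : j = i₀ := by
            by_contra h
            exact hy ((hmem _).2 ⟨j, h, rfl⟩)
          rw [this]
          exact hf.slack_le _ _
  · rintro y ⟨hyτ, hy⟩
    obtain ⟨i, hi⟩ := hy x
    by_cases h : i = i₀
    · subst h
      exact hf.injective i (le_antisymm (hmax y (by simp [hyτ])) (hi y (mem_insert_self _ _)))
    · have := hf.injective i (le_antisymm (hi (Sum.inr i)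
        (mem_insert_of_mem ((hmem _).2 ⟨i, h, rfl⟩))) (hf.slack_le i x))
      exact absurd ((hmem x).2 ⟨i, h, this⟩) hxτ

/-- A dominant set one element short, other than the slack elements without one of them, extends
to exactly two dominant sets. -/
theorem IsSlackRanking.exists_pair_dominant_insert (hf : IsSlackRanking f)
    {τ : Finset (T ⊕ I)} (hdom : Dominant f τ) (hcard : #τ + 1 = Fintype.card I)
    (hτ : ∀ b, τ ≠ (univ.erase b).map Function.Embedding.inr) :
    ∃ x y, x ≠ y ∧ ∀ z, (z ∉ τ ∧ Dominant f (insert z τ)) ↔ z = x ∨ z = y := by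
  classical
  have hne : τ.Nonempty := by
    rw [nonempty_iff_ne_empty]
    rintro rfl
    obtain ⟨b, hb⟩ := Fintype.card_eq_one_iff.1 (by simpa using hcard.symm)
    refine hτ b (eq_comm.1 ?_)
    simp [eq_empty_iff_forall_notMem, hb]
  have hτslack : ∀ i j, (i ≠ j) → Sum.inr i ∉ τ → Sum.inr j ∉ τ → ∃ t, Sum.inl t ∈ τ := by
    intro i j hij hi hj
    by_contra! h
    have hsub : τ ⊆ ((univ.erase i).erase j).map Function.Embedding.inr := by
      rintro (t | k) hk
      · exact absurd hk (h t)
      · simp only [mem_map, mem_erase, mem_univ, Function.Embedding.inr_apply, Sum.inr.injEq,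
          exists_eq_right, and_true]
        exact ⟨fun e => hj (e ▸ hk), fun e => hi (e ▸ hk)⟩
    have := card_le_card hsub
    rw [card_map, card_erase_of_mem (by simp [hij.symm]), card_erase_of_mem (mem_univ _),
      card_univ] at this
    have : 2 ≤ Fintype.card I := by
      have := card_le_card (subset_univ ({i, j} : Finset I))
      rwa [card_pair hij, card_univ] at this
    omega
  choose m hm hmin using fun i => exists_min_image τ (f i) hne
  have hsurj : ∀ t ∈ τ, ∃ i, m i = t := by
    intro t ht
    obtain ⟨i, hi⟩ := hdom t
    exact ⟨i, hf.injective i (le_antisymm (hmin i t ht) (hi _ (hm i)))⟩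
  have himg : univ.image m = τ := by
    ext t
    simp only [mem_image, mem_univ, true_and]
    exact ⟨fun ⟨i, hi⟩ => hi ▸ hm i, hsurj t⟩
  obtain ⟨a, -, b, -, hab, hmab, hpair⟩ := exists_pair_of_card_eq_succ univ m (by
    rw [himg, card_univ, hcard])
  rw [himg] at hpair
  have hM : ∀ p q, p ≠ q → m p = m q → ∃ y, ∀ i, i ≠ p → f i (m i) < f i y := by
    intro p q hpq hmpq
    by_cases hp : Sum.inr p ∈ τ
    · exfalso
      have hmp : m p = Sum.inr p :=
        hf.injective p (le_antisymm (hmin p _ hp) (hf.slack_le _ _))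
      have hq : Sum.inr q ∉ τ := by
        intro hq
        have hmq : m q = Sum.inr q :=
          hf.injective q (le_antisymm (hmin q _ hq) (hf.slack_le _ _))
        rw [hmpq, hmq] at hmp
        exact hpq (Sum.inr.inj hmp).symm
      have hno : ∀ t, Sum.inl t ∉ τ := by
        intro t ht
        have h1 := hmin q _ ht
        rw [← hmpq, hmp] at h1
        exact absurd h1 (not_le.2 (hf.lt_slack q p t hpq.symm))
      refine hτ q (eq_of_subset_of_card_le ?_ ?_)
      · rintro (t | k) hk
        · exact absurd hk (hno t)
        · simp only [mem_map, mem_erase, mem_univ, Function.Embedding.inr_apply, Sum.inr.injEq,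
            exists_eq_right, and_true]
          exact fun e => hq (e ▸ hk)
      · rw [card_map, card_erase_of_mem (mem_univ _), card_univ]
        omega
    · refine ⟨Sum.inr p, fun i hi => ?_⟩
      rcases hmi : m i with t | j
      · exact hf.lt_slack i p t hi
      · by_cases hij : i = j
        · subst hij
          exact lt_of_le_of_ne (hf.slack_le _ _) fun h => hi (Sum.inr.inj (hf.injective _ h))
        · exfalso
          have hi' : Sum.inr i ∉ τ := by
            intro h
            have := hf.injective i (le_antisymm (hmin i _ h) (hf.slack_le _ _))
            rw [hmi] at this
            exact hij (Sum.inr.inj this).symm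
          obtain ⟨t, ht⟩ := hτslack i p hi hi' hp
          have := hmin i _ ht
          rw [hmi] at this
          exact absurd this (not_le.2 (hf.lt_slack i j t hij))
  have hmaxM : ∀ p q, p ≠ q → m p = m q → ∃ y, (∀ i, i ≠ p → f i (m i) < f i y) ∧
      ∀ z, (∀ i, i ≠ p → f i (m i) < f i z) → f p z ≤ f p y := by
    intro p q hpq hmpq
    obtain ⟨y, hy⟩ := hM p q hpq hmpq
    obtain ⟨x, hx, hxm⟩ := exists_max_image
      (univ.filter fun y => ∀ i, i ≠ p → f i (m i) < f i y) (f p) ⟨y, by simpa using hy⟩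
    exact ⟨x, by simpa using hx, fun z hz => hxm z (by simpa using hz)⟩
  have hroom : ∀ p q y, p ≠ q → m p = m q → (∀ i, i ≠ p → f i (m i) < f i y) →
      (∀ z, (∀ i, i ≠ p → f i (m i) < f i z) → f p z ≤ f p y) →
      y ∉ τ ∧ Dominant f (insert y τ) := by
    intro p q y hpq hmpq hy hymax
    refine ⟨fun hyτ => ?_, fun z => ?_⟩
    · obtain ⟨i, hi⟩ := hsurj y hyτ
      by_cases h : i = p
      · rw [h, hmpq] at hi
        exact absurd (hy q hpq.symm) (by rw [hi]; exact lt_irrefl _)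
      · exact absurd (hy i h) (by rw [hi]; exact lt_irrefl _)
    · by_cases hz : ∀ i, i ≠ p → f i (m i) < f i z
      · have hyp : ∀ t ∈ τ, f p y ≤ f p t := by
          obtain ⟨i, hi⟩ := hdom y
          by_cases h : i = p
          · exact h ▸ hi
          · exact absurd (hi _ (hm i)) (not_le.2 (hy i h))
        refine ⟨p, fun t ht => ?_⟩
        rcases mem_insert.1 ht with rfl | ht
        · exact hymax z hz
        · exact (hymax z hz).trans (hyp t ht)
      · push Not at hz
        obtain ⟨i, hip, hi⟩ := hz
        refine ⟨i, fun t ht => ?_⟩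
        rcases mem_insert.1 ht with rfl | ht
        · exact hi.trans (hy i hip).le
        · exact hi.trans (hmin i t ht)
  obtain ⟨x, hx, hxm⟩ := hmaxM a b hab hmab
  obtain ⟨y, hy, hym⟩ := hmaxM b a hab.symm hmab.symm
  refine ⟨x, y, ?_, fun z => ⟨?_, ?_⟩⟩
  · rintro rfl
    obtain ⟨i, hi⟩ := hdom x
    by_cases h : i = a
    · exact absurd (hi _ (hm i)) (not_le.2 (hy i (h ▸ hab)))
    · exact absurd (hi _ (hm i)) (not_le.2 (hx i h))
  · rintro ⟨hzτ, hz⟩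
    obtain ⟨j, hj⟩ := hz z
    have hex : ∀ t ∈ τ, ∃ i, i ≠ j ∧ m i = t ∧ f i t ≤ f i z := by
      intro t ht
      obtain ⟨i, hi⟩ := hz t
      refine ⟨i, ?_, hf.injective i (le_antisymm (hmin i t ht)
        (hi _ (mem_insert_of_mem (hm i)))), hi z (mem_insert_self _ _)⟩
      rintro rfl
      have := hf.injective i (le_antisymm (hi z (mem_insert_self _ _))
        (hj t (mem_insert_of_mem ht)))
      exact hzτ (this ▸ ht)
    have himj : (univ.erase j).image m = τ := by
      ext t
      simp only [mem_image, mem_erase, mem_univ, and_true]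
      exact ⟨fun ⟨i, _, hi⟩ => hi ▸ hm i, fun ht => (hex t ht).imp fun i hi => ⟨hi.1, hi.2.1⟩⟩
    have hinj : Set.InjOn m ((univ.erase j : Finset I) : Set I) := by
      rw [← card_image_iff, himj, card_erase_of_mem (mem_univ _), card_univ]
      omega
    have hzM : ∀ i, i ≠ j → f i (m i) < f i z := by
      intro i hi
      obtain ⟨k, hkj, hk, hle⟩ := hex (m i) (hm i)
      have : k = i := hinj (by simp [hkj]) (by simp [hi]) hk
      subst this
      exact lt_of_le_of_ne hle fun h => hzτ (hf.injective _ h ▸ hm k)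
    have hzmax : ∀ w, (∀ i, i ≠ j → f i (m i) < f i w) → f j w ≤ f j z := by
      intro w hw
      obtain ⟨i, hi⟩ := hz w
      by_cases h : i = j
      · exact h ▸ hi z (mem_insert_self _ _)
      · exact absurd (hi _ (mem_insert_of_mem (hm i))) (not_le.2 (hw i h))
    rcases (hpair j (mem_univ _)).1 himj with rfl | rfl
    · exact Or.inl (hf.injective j (le_antisymm (hxm z hzM) (hzmax x hx)))
    · exact Or.inr (hf.injective j (le_antisymm (hym z hzM) (hzmax y hy)))
  · rintro (rfl | rfl)
    · exact hroom a b z hab hmab hx hxm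
    · exact hroom b a z hab.symm hmab.symm hy hym

/-- **Scarf's lemma** for colourings: some dominant set meets every colour exactly once. -/
theorem IsSlackRanking.exists_dominant_colorful [Nonempty T] [Nonempty I]
    (hf : IsSlackRanking f) (c : T ⊕ I → I) (hc : ∀ i, c (Sum.inr i) = i) :
    ∃ σ : Finset (T ⊕ I), Dominant f σ ∧ #σ = Fintype.card I ∧ σ.image c = univ := by
  classical
  by_contra! hno
  obtain ⟨i₀⟩ := ‹Nonempty I›
  have hI : 0 < Fintype.card I := Fintype.card_pos_iff.2 ⟨i₀⟩
  set τ₀ : Finset (T ⊕ I) := (univ.erase i₀).map Function.Embedding.inr with hτ₀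
  set doors : Finset (Finset (T ⊕ I)) := univ.filter fun τ =>
    Dominant f τ ∧ #τ + 1 = Fintype.card I ∧ τ.image c = univ.erase i₀ with hdoors
  set rooms : Finset (Finset (T ⊕ I)) := univ.filter fun σ =>
    Dominant f σ ∧ #σ = Fintype.card I ∧ σ.image c = univ.erase i₀ with hrooms
  have hcount := sum_card_bipartiteAbove_eq_sum_card_bipartiteBelow
    (s := doors) (t := rooms) (fun τ σ => τ ⊆ σ)
  have habove : ∀ τ ∈ doors, ∀ σ, σ ∈ bipartiteAbove (fun τ σ => τ ⊆ σ) rooms τ ↔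
      ∃ z, (z ∉ τ ∧ Dominant f (insert z τ)) ∧ insert z τ = σ := by
    intro τ hτ σ
    simp only [hdoors, mem_filter, mem_univ, true_and] at hτ
    simp only [mem_bipartiteAbove, hrooms, mem_filter, mem_univ, true_and]
    constructor
    · rintro ⟨⟨hd, hcd, -⟩, hsub⟩
      obtain ⟨z, hz, rfl⟩ := (covBy_iff_exists_insert.1 (covBy_iff_card_sdiff_eq_one.2
        ⟨hsub, by rw [card_sdiff_of_subset hsub]; omega⟩))
      exact ⟨z, ⟨hz, hd⟩, rfl⟩
    · rintro ⟨z, ⟨hz, hd⟩, rfl⟩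
      have hcd : #(insert z τ) = Fintype.card I := by rw [card_insert_of_notMem hz, hτ.2.1]
      refine ⟨⟨hd, hcd, ?_⟩, subset_insert _ _⟩
      have h1 := hno _ hd hcd
      rw [image_insert, hτ.2.2] at h1 ⊢
      by_cases h : c z = i₀
      · rw [h, insert_erase (mem_univ _)] at h1
        exact absurd rfl h1
      · exact insert_eq_of_mem (by simp [h])
  have hbelow : ∀ σ ∈ rooms, #(bipartiteBelow (fun τ σ => τ ⊆ σ) doors σ) = 2 := by
    intro σ hσ
    simp only [hrooms, mem_filter, mem_univ, true_and] at hσ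
    obtain ⟨hd, hcd, him⟩ := hσ
    obtain ⟨a, ha, b, hb, hab, -, hpair⟩ := exists_pair_of_card_eq_succ σ c (by
      rw [him, hcd, card_erase_of_mem (mem_univ _), card_univ]; omega)
    rw [him] at hpair
    have : bipartiteBelow (fun τ σ => τ ⊆ σ) doors σ = {σ.erase a, σ.erase b} := by
      ext τ
      simp only [mem_bipartiteBelow, hdoors, mem_filter, mem_univ, true_and, mem_insert,
        mem_singleton]
      constructor
      · rintro ⟨⟨-, hcτ, hτ⟩, hsub⟩
        obtain ⟨z, hz, rfl⟩ := (covBy_iff_exists_erase.1 (covBy_iff_card_sdiff_eq_one.2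
          ⟨hsub, by rw [card_sdiff_of_subset hsub]; omega⟩))
        rcases (hpair z hz).1 hτ with rfl | rfl <;> simp
      · have key : ∀ z ∈ σ, (z = a ∨ z = b) → (Dominant f (σ.erase z) ∧
            #(σ.erase z) + 1 = Fintype.card I ∧ (σ.erase z).image c = univ.erase i₀) ∧
            σ.erase z ⊆ σ := fun z hz hzab =>
          ⟨⟨hd.mono (erase_subset _ _), by rw [card_erase_add_one hz, hcd],
            (hpair z hz).2 hzab⟩, erase_subset _ _⟩
        rintro (rfl | rfl)
        · exact key a ha (Or.inl rfl)
        · exact key b hb (Or.inr rfl)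
    rw [this, card_pair]
    intro h
    have : a ∈ σ.erase b := by simp [ha, hab]
    simp [← h] at this
  have hτ₀mem : τ₀ ∈ doors := by
    simp only [hdoors, mem_filter, mem_univ, true_and]
    obtain ⟨x, ⟨-, hx⟩, -⟩ := hf.existsUnique_dominant_insert i₀
    refine ⟨hx.mono (subset_insert _ _), ?_, ?_⟩
    · rw [hτ₀, card_map, card_erase_of_mem (mem_univ _), card_univ]
      omega
    · ext i
      simp [hτ₀, hc]
  have hτ₀above : #(bipartiteAbove (fun τ σ => τ ⊆ σ) rooms τ₀) = 1 := by
    obtain ⟨x, hx, hxu⟩ := hf.existsUnique_dominant_insert i₀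
    refine card_eq_one.2 ⟨insert x τ₀, ?_⟩
    ext σ
    rw [habove τ₀ hτ₀mem, mem_singleton]
    constructor
    · rintro ⟨z, hz, rfl⟩
      rw [hxu z hz]
    · rintro rfl
      exact ⟨x, hx, rfl⟩
  have habove2 : ∀ τ ∈ doors.erase τ₀, #(bipartiteAbove (fun τ σ => τ ⊆ σ) rooms τ) = 2 := by
    intro τ hτ
    obtain ⟨hne, hτd⟩ := mem_erase.1 hτ
    have hτd' := hτd
    simp only [hdoors, mem_filter, mem_univ, true_and] at hτd'
    obtain ⟨hd, hcd, him⟩ := hτd'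
    obtain ⟨x, y, hxy, hiff⟩ := hf.exists_pair_dominant_insert hd hcd (by
      rintro b rfl
      refine hne ?_
      have : univ.erase b = univ.erase i₀ := by
        rw [← him]
        ext i
        simp [hc]
      rw [hτ₀, this])
    have hx := ((hiff x).2 (Or.inl rfl)).1
    have : bipartiteAbove (fun τ σ => τ ⊆ σ) rooms τ = {insert x τ, insert y τ} := by
      ext σ
      rw [habove τ hτd, mem_insert, mem_singleton]
      simp only [hiff]
      constructor
      · rintro ⟨z, rfl | rfl, rfl⟩ <;> simp
      · rintro (rfl | rfl)
        exacts [⟨x, Or.inl rfl, rfl⟩, ⟨y, Or.inr rfl, rfl⟩]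
    rw [this, card_pair]
    intro h
    have h2 : x ∈ insert y τ := h ▸ mem_insert_self _ _
    rcases mem_insert.1 h2 with h2 | h2
    exacts [hxy h2, hx h2]
  rw [sum_congr rfl hbelow, ← add_sum_erase _ _ hτ₀mem, hτ₀above, sum_congr rfl habove2] at hcount
  simp only [sum_const, smul_eq_mul] at hcount
  omega

end Scarf

/-- In every colouring of the lattice points of a dilated simplex, some lattice point is, for each
index, close to the facet of that index or to a point of that colour. -/
theorem exists_lattice_near_all_colors {I : Type*} [Fintype I] [Nonempty I] (N : ℕ)
    (c : (I → ℕ) → I) :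
    ∃ z : I → ℕ, ∑ k, z k = N ∧ ∀ i, z i ≤ Fintype.card I ∨
      ∃ w : I → ℕ, ∑ k, w k = N ∧ c w = i ∧ ∀ k, w k ≤ z k + Fintype.card I ∧
        z k ≤ w k + Fintype.card I := by
  classical
  let T := {k : I → Fin (N + 1) // ∑ i, (k i : ℕ) = N}
  obtain ⟨i₁⟩ := ‹Nonempty I›
  have hle : ∀ k : I → ℕ, ∑ i, k i = N → ∀ i, k i < N + 1 := fun k hk i =>
    Nat.lt_succ_of_le (hk ▸ single_le_sum (f := k) (fun _ _ => Nat.zero_le _) (mem_univ i))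
  let mk : ∀ k : I → ℕ, ∑ i, k i = N → T := fun k hk => ⟨fun i => ⟨k i, hle k hk i⟩, hk⟩
  have : Nonempty T := ⟨mk (Pi.single i₁ N) (by simp)⟩
  have : Nonempty I := ⟨i₁⟩
  let g : I → T ⊕ I → ℤ := fun i => Sum.elim (fun k => ((k.1 i : ℕ) : ℤ))
    (fun j => if i = j then -1 else N + 1)
  let idx : T ⊕ I → Fin (Fintype.card (T ⊕ I)) := Fintype.equivFin _
  have hidx : Function.Injective idx := (Fintype.equivFin _).injective
  let f : I → T ⊕ I → ℤ ×ₗ Fin (Fintype.card (T ⊕ I)) := fun i x => toLex (g i x, idx x)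
  have hfst : ∀ i x y, f i x ≤ f i y → g i x ≤ g i y := by
    intro i x y h
    rcases (Prod.Lex.toLex_le_toLex.1 h) with h | h
    exacts [h.le, h.1.le]
  have hf : IsSlackRanking f := by
    refine ⟨fun i x y h => hidx (congrArg (fun p => (ofLex p).2) h), fun i x => ?_,
      fun i j t hij => ?_⟩
    · rcases x with t | j
      · refine (Prod.Lex.toLex_lt_toLex.2 (Or.inl ?_)).le
        simp only [g, Sum.elim_inl, Sum.elim_inr, if_true]
        omega
      · by_cases hij : i = j
        · rw [hij]
        · refine (Prod.Lex.toLex_lt_toLex.2 (Or.inl ?_)).le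
          simp only [g, Sum.elim_inr, if_true, if_neg hij]
          omega
    · refine Prod.Lex.toLex_lt_toLex.2 (Or.inl ?_)
      simp only [g, Sum.elim_inl, Sum.elim_inr, if_neg hij]
      have := (t.1 i).2
      omega
  obtain ⟨σ, hdom, hcard, himg⟩ := hf.exists_dominant_colorful
    (Sum.elim (fun t => c fun i => t.1 i) id) (fun i => rfl)
  set C : T ⊕ I → I := Sum.elim (fun t => c fun i => t.1 i) id with hC
  have hinj : Set.InjOn C σ := by
    rw [← card_image_iff, himg, hcard, card_univ]
  have hsurj : ∀ i, ∃ x ∈ σ, C x = i := fun i => by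
    simpa using (himg ▸ mem_univ i : i ∈ σ.image C)
  -- some lattice point lies in `σ`
  obtain ⟨s, hs⟩ : ∃ s : T, Sum.inl s ∈ σ := by
    by_contra! h
    obtain ⟨t⟩ := ‹Nonempty T›
    obtain ⟨i, hi⟩ := hdom (Sum.inl t)
    obtain ⟨x | j, hx, hxi⟩ := hsurj i
    · exact h x hx
    · have hj : j = i := hxi
      subst hj
      have := hfst _ _ _ (hi _ hx)
      simp only [g, Sum.elim_inl, Sum.elim_inr, if_true] at this
      omega
  set A : Finset I := univ.filter fun i => Sum.inr i ∉ σ with hA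
  have hmemA : ∀ i, i ∈ A ↔ Sum.inr i ∉ σ := fun i => by simp [hA]
  have hsA : C (Sum.inl s) ∈ A := by
    rw [hmemA]
    intro h
    exact Sum.inl_ne_inr (hinj hs h rfl)
  -- coordinatewise minimum over the lattice points in `σ`
  have hmin : ∀ i, ∃ m : ℕ, (∀ t : T, Sum.inl t ∈ σ → m ≤ (t.1 i : ℕ)) ∧
      ∃ t : T, Sum.inl t ∈ σ ∧ (t.1 i : ℕ) = m := by
    intro i
    obtain ⟨t, ht, htm⟩ := exists_min_image (univ.filter fun t : T => Sum.inl t ∈ σ)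
      (fun t => (t.1 i : ℕ)) ⟨s, by simpa using hs⟩
    exact ⟨t.1 i, fun u hu => htm u (by simpa using hu), t, by simpa using ht, rfl⟩
  choose m hmle hmeq using hmin
  have hsum : N < ∑ i ∈ A, (m i + 1) := by
    by_contra! hlt
    set i₂ := C (Sum.inl s) with hi₂
    let y : I → ℕ := fun i => if i ∈ A then
      m i + 1 + (if i = i₂ then N - ∑ i ∈ A, (m i + 1) else 0) else 0
    have hy : ∑ i, y i = N := by
      simp only [y]
      rw [← sum_filter, filter_mem_eq_inter, univ_inter, sum_add_distrib,
        sum_ite_eq', if_pos hsA]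
      omega
    obtain ⟨i, hi⟩ := hdom (Sum.inl (mk y hy))
    by_cases hiA : i ∈ A
    · obtain ⟨t, ht, htm⟩ := hmeq i
      have := hfst _ _ _ (hi _ ht)
      simp only [g, Sum.elim_inl, mk, y, if_pos hiA] at this
      omega
    · rw [hmemA, not_not] at hiA
      have := hfst _ _ _ (hi _ hiA)
      simp only [g, Sum.elim_inl, Sum.elim_inr, if_true] at this
      omega
  have hAcard : #A ≤ Fintype.card I := card_le_univ A
  rw [sum_add_distrib, sum_const, smul_eq_mul, mul_one] at hsum
  have htsum : ∀ t : T, Sum.inl t ∈ σ → ∀ k, (k ∉ A → (t.1 k : ℕ) ≤ Fintype.card I) ∧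
      (k ∈ A → (t.1 k : ℕ) ≤ m k + Fintype.card I) := by
    intro t ht k
    have htot := t.2
    rw [← sum_add_sum_compl A] at htot
    constructor
    · intro hk
      have h1 := sum_le_sum fun i (_ : i ∈ A) => hmle i t ht
      have h2 := single_le_sum (f := fun i => (t.1 i : ℕ)) (fun _ _ => Nat.zero_le _)
        (mem_compl.2 hk)
      omega
    · intro hk
      have h1 := sum_le_sum fun i (_ : i ∈ A.erase k) => hmle i t ht
      have h2 := add_sum_erase A (fun i => (t.1 i : ℕ)) hk
      have h3 := add_sum_erase A m hk
      omega
  refine ⟨fun k => s.1 k, s.2, fun i => ?_⟩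
  by_cases hiA : i ∈ A
  · refine Or.inr ?_
    obtain ⟨t | j, ht, hti⟩ := hsurj i
    · refine ⟨fun k => t.1 k, t.2, hti, fun k => ?_⟩
      have h1 := htsum t ht k
      have h2 := htsum s hs k
      have h3 := hmle k t ht
      have h4 := hmle k s hs
      by_cases hk : k ∈ A
      · have := h1.2 hk
        have := h2.2 hk
        exact ⟨by linarith, by linarith⟩
      · have := h1.1 hk
        have := h2.1 hk
        exact ⟨by linarith, by linarith⟩
    · have hj : j = i := hti
      exact absurd (hj ▸ ht) ((hmemA i).1 hiA)
  · exact Or.inl ((htsum s hs i).1 hiA)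

open Filter Topology in
/-- **Brouwer's fixed point theorem** for the standard simplex. -/
theorem exists_fixedPoint_stdSimplex {I : Type*} [Fintype I] [Nonempty I] (F : (I → ℝ) → I → ℝ)
    (hF : ContinuousOn F (stdSimplex ℝ I)) (hmaps : Set.MapsTo F (stdSimplex ℝ I) (stdSimplex ℝ I)) :
    ∃ x ∈ stdSimplex ℝ I, F x = x := by
  classical
  have hcol : ∀ x ∈ stdSimplex ℝ I, ∃ i, x i ≤ F x i := by
    intro x hx
    obtain ⟨i, -, hi⟩ := exists_le_of_sum_le (s := univ) (f := x) (g := F x) univ_nonempty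
      (by rw [hx.2, (hmaps hx).2])
    exact ⟨i, hi⟩
  let d : ℝ := Fintype.card I
  let sc : ℕ → (I → ℕ) → I → ℝ := fun N z k => (z k : ℝ) / (N + 1)
  have hsc : ∀ N z, ∑ k, z k = N + 1 → sc N z ∈ stdSimplex ℝ I := by
    intro N z hz
    refine ⟨fun k => by positivity, ?_⟩
    simp only [sc]
    rw [← sum_div, ← Nat.cast_sum, hz]
    push_cast
    exact div_self (by positivity)
  have happrox : ∀ N : ℕ, ∃ z ∈ stdSimplex ℝ I, ∀ i, ∃ w ∈ stdSimplex ℝ I,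
      w i - d / (N + 1) ≤ F w i ∧ ∀ k, |w k - z k| ≤ d / (N + 1) := by
    intro N
    have hN : (0 : ℝ) < N + 1 := by positivity
    obtain ⟨z, hz, h⟩ := exists_lattice_near_all_colors (I := I) (N + 1) fun k =>
      if hk : sc N k ∈ stdSimplex ℝ I then (hcol _ hk).choose else Classical.arbitrary I
    refine ⟨sc N z, hsc N z hz, fun i => ?_⟩
    rcases h i with h | ⟨w, hw, hwi, hwz⟩
    · refine ⟨sc N z, hsc N z hz, ?_, fun k => by simp; positivity⟩
      have h1 := (hmaps (hsc N z hz)).1 i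
      have h2 : sc N z i ≤ d / (N + 1) := by
        simp only [sc, d]
        gcongr
      linarith
    · refine ⟨sc N w, hsc N w hw, ?_, fun k => ?_⟩
      · rw [dif_pos (hsc N w hw)] at hwi
        have h1 := (hcol _ (hsc N w hw)).choose_spec
        rw [hwi] at h1
        have : 0 ≤ d / (N + 1) := by positivity
        linarith
      · simp only [sc, d]
        rw [← sub_div, abs_div, abs_of_pos hN]
        gcongr
        have h1 : (w k : ℝ) ≤ z k + Fintype.card I := by exact_mod_cast (hwz k).1
        have h2 : (z k : ℝ) ≤ w k + Fintype.card I := by exact_mod_cast (hwz k).2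
        rw [abs_le]
        constructor <;> linarith
  choose z hz w hw hwF hwz using happrox
  obtain ⟨x, hx, φ, hφ, hlim⟩ := (isCompact_stdSimplex ℝ I).tendsto_subseq hz
  have hd : Tendsto (fun n => d / ((φ n : ℝ) + 1)) atTop (𝓝 0) :=
    ((tendsto_const_div_atTop_nhds_zero_nat d).comp (tendsto_add_atTop_nat 1)).comp
      hφ.tendsto_atTop |>.congr fun n => by simp
  have hwlim : ∀ i, Tendsto (fun n => w (φ n) i) atTop (𝓝 x) := by
    intro i
    rw [tendsto_pi_nhds] at hlim ⊢
    intro k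
    have h0 : Tendsto (fun n => w (φ n) i k - z (φ n) k) atTop (𝓝 0) :=
      squeeze_zero_norm (fun n => hwz (φ n) i k) hd
    simpa using h0.add (hlim k)
  have hle : ∀ i, x i ≤ F x i := by
    intro i
    have h1 : Tendsto (fun n => F (w (φ n) i) i) atTop (𝓝 (F x i)) := by
      have h2 : Tendsto (fun n => w (φ n) i) atTop (𝓝[stdSimplex ℝ I] x) :=
        tendsto_nhdsWithin_iff.2 ⟨hwlim i, Eventually.of_forall fun n => hw (φ n) i⟩
      exact (tendsto_pi_nhds.1 ((hF x hx).tendsto.comp h2)) i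
    have h3 := ((tendsto_pi_nhds.1 (hwlim i)) i).sub hd
    rw [sub_zero] at h3
    exact le_of_tendsto_of_tendsto' h3 h1 fun n => hwF (φ n) i
  refine ⟨x, hx, funext fun i => ?_⟩
  exact ((sum_eq_sum_iff_of_le fun i _ => hle i).1 (by rw [hx.2, (hmaps hx).2]) i
    (mem_univ i)).symm

/-- **Brouwer's fixed point theorem** for the unit cube. -/
theorem exists_fixedPoint_Icc {ι : Type*} [Fintype ι] (G : (ι → ℝ) → ι → ℝ)
    (hG : ContinuousOn G (Set.Icc 0 1)) (hmaps : Set.MapsTo G (Set.Icc 0 1) (Set.Icc 0 1)) :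
    ∃ x ∈ Set.Icc (0 : ι → ℝ) 1, G x = x := by
  set D : ℝ := Fintype.card ι + 1 with hD
  have hDpos : 0 < D := by positivity
  let P : (Option ι → ℝ) → ι → ℝ := fun z i => max 0 (min 1 (D * z (some i)))
  have hP : ∀ z, P z ∈ Set.Icc (0 : ι → ℝ) 1 := fun z =>
    ⟨fun i => le_max_left _ _, fun i => max_le zero_le_one (min_le_left _ _)⟩
  have hPc : Continuous P := by
    simp only [P]
    fun_prop
  have hGP : ∀ i, Continuous fun z => G (P z) i :=
    continuous_pi_iff.1 (hG.comp_continuous hPc hP)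
  let F : (Option ι → ℝ) → Option ι → ℝ := fun z o =>
    o.elim (1 - ∑ i, G (P z) i / D) fun i => G (P z) i / D
  have hFc : Continuous F := by
    refine continuous_pi fun o => ?_
    rcases o with _ | i
    · exact continuous_const.sub (continuous_finsetSum _ fun i _ => (hGP i).div_const D)
    · exact (hGP i).div_const D
  obtain ⟨z, -, hz⟩ := exists_fixedPoint_stdSimplex F hFc.continuousOn (by
    intro z _
    have h := hmaps (hP z)
    refine ⟨?_, by simp [F, Fintype.sum_option]⟩
    rintro (_ | i)
    · simp only [F, Option.elim]
      rw [← sum_div, sub_nonneg, div_le_one hDpos]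
      calc ∑ i, G (P z) i ≤ ∑ _i : ι, (1 : ℝ) := sum_le_sum fun i _ => h.2 i
        _ ≤ D := by simp [hD]
    · exact div_nonneg (h.1 i) hDpos.le)
  have hPz : G (P z) = P z := by
    funext i
    have h1 : G (P z) i / D = z (some i) := congrFun hz (some i)
    rw [div_eq_iff hDpos.ne'] at h1
    have h := hmaps (hP z)
    have h0 := h.1 i
    have h2 := h.2 i
    simp only [Pi.zero_apply, Pi.one_apply] at h0 h2
    change _ = max 0 (min 1 (D * z (some i)))
    rw [mul_comm, ← h1, min_eq_right h2, max_eq_right h0]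
  exact ⟨P z, hP z, hPz⟩

open Filter Topology in
/-- Finitely many nonnegative reals stay nonnegative under some `ℚ`-linear retraction `ℝ → ℚ`. -/
theorem exists_linearMap_rat_nonneg (S : Set ℝ) (hS : S.Finite) :
    ∃ φ : ℝ →ₗ[ℚ] ℚ, φ 1 = 1 ∧ ∀ s ∈ S, 0 ≤ s → 0 ≤ φ s := by
  have hli : LinearIndepOn ℚ id ({1} : Set ℝ) := LinearIndepOn.singleton one_ne_zero
  let b := Module.Basis.extend hli
  have hb : ∀ j, b j = j := fun j => Module.Basis.extend_apply_self hli j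
  let φ : ℕ → ℝ →ₗ[ℚ] ℚ := fun m =>
    b.constr ℚ fun j => (⌊(j : ℝ) * (m + 1)⌋ : ℚ) / (m + 1)
  have hone : ∀ m, φ m 1 = 1 := by
    intro m
    have h1 : (1 : ℝ) ∈ hli.extend (Set.subset_univ _) :=
      hli.subset_extend (Set.subset_univ _) rfl
    have h2 : b ⟨1, h1⟩ = 1 := hb _
    conv_lhs => rw [← h2]
    simp only [φ, Module.Basis.constr_basis, one_mul]
    have : ⌊(m : ℝ) + 1⌋ = (m : ℤ) + 1 := by
      rw [Int.floor_eq_iff]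
      push_cast
      constructor <;> linarith
    rw [this]
    push_cast
    exact div_self (by positivity)
  have hj : ∀ x : ℝ, Tendsto (fun m : ℕ => (⌊x * (m + 1)⌋ : ℝ) / (m + 1)) atTop (𝓝 x) := by
    intro x
    have h : Tendsto (fun m : ℕ => (m : ℝ) + 1) atTop atTop :=
      tendsto_atTop_add_const_right _ _ tendsto_natCast_atTop_atTop
    have h0 : Tendsto (fun m : ℕ => x - 1 / ((m : ℝ) + 1)) atTop (𝓝 x) := by
      simpa using tendsto_const_nhds.sub (tendsto_one_div_add_atTop_nhds_zero_nat (𝕜 := ℝ))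
    refine tendsto_of_tendsto_of_tendsto_of_le_of_le h0 tendsto_const_nhds (fun m => ?_) fun m => ?_
    · have hm : (0 : ℝ) < m + 1 := by positivity
      rw [le_div_iff₀ hm, sub_mul, one_div_mul_cancel hm.ne']
      exact (Int.sub_one_lt_floor _).le
    · have hm : (0 : ℝ) < m + 1 := by positivity
      simp only
      rw [div_le_iff₀ hm]
      exact Int.floor_le _
  have hlim : ∀ s : ℝ, Tendsto (fun m => ((φ m s : ℚ) : ℝ)) atTop (𝓝 s) := by
    intro s
    have hs : s = ∑ j ∈ (b.repr s).support, ((b.repr s j : ℚ) : ℝ) * (j : ℝ) := by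
      conv_lhs => rw [← b.linearCombination_repr s]
      rw [Finsupp.linearCombination_apply, Finsupp.sum]
      exact sum_congr rfl fun j _ => by rw [hb, Rat.smul_def]
    have hφs : ∀ m, ((φ m s : ℚ) : ℝ) = ∑ j ∈ (b.repr s).support,
        ((b.repr s j : ℚ) : ℝ) * ((⌊(j : ℝ) * (m + 1)⌋ : ℝ) / (m + 1)) := by
      intro m
      simp only [φ, Module.Basis.constr_apply, Finsupp.sum, smul_eq_mul]
      push_cast
      rfl
    simp only [hφs]
    conv in 𝓝 s => rw [hs]
    exact tendsto_finsetSum _ fun j _ => (hj j).const_mul _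
  have hev : ∀ s ∈ S, ∀ᶠ m in atTop, 0 ≤ s → 0 ≤ φ m s := by
    intro s _
    rcases lt_trichotomy s 0 with h | h | h
    · exact Eventually.of_forall fun m h' => absurd h' (not_le.2 h)
    · exact Eventually.of_forall fun m _ => by simp [h]
    · filter_upwards [(hlim s).eventually (lt_mem_nhds h)] with m hm _
      exact_mod_cast hm.le
  obtain ⟨m, hm⟩ := ((eventually_all_finite hS).2 hev).exists
  exact ⟨φ m, hone m, hm⟩

/-- A self-map of the unit cube whose coordinates are minima of two rational affine functions has
a rational fixed point. -/
theorem exists_rat_fixedPoint_min_affine {ι : Type*} [Fintype ι] (p q : ι → ℚ) (M N : ι → ι → ℚ)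
    (hmaps : ∀ v ∈ Set.Icc (0 : ι → ℝ) 1,
      (fun i => min (p i + ∑ j, M i j * v j) (q i + ∑ j, N i j * v j)) ∈ Set.Icc (0 : ι → ℝ) 1) :
    ∃ v : ι → ℚ, (∀ i, 0 ≤ v i ∧ v i ≤ 1) ∧
      ∀ i, v i = min (p i + ∑ j, M i j * v j) (q i + ∑ j, N i j * v j) := by
  obtain ⟨x, hx, hfix⟩ := exists_fixedPoint_Icc
    (fun v i => min (p i + ∑ j, M i j * v j) (q i + ∑ j, N i j * v j))
    (by fun_prop) hmaps
  let aff : (ι → ℚ) → (ι → ι → ℚ) → ι → ℝ := fun p M i => p i + ∑ j, M i j * x j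
  obtain ⟨φ, hone, hφ⟩ := exists_linearMap_rat_nonneg
    (Set.range x ∪ Set.range (1 - x) ∪ Set.range (aff q N - aff p M) ∪
      Set.range (aff p M - aff q N))
    ((((Set.finite_range _).union (Set.finite_range _)).union (Set.finite_range _)).union
      (Set.finite_range _))
  have haff : ∀ p M i, φ (aff p M i) = p i + ∑ j, M i j * φ (x j) := by
    intro p M i
    have h1 : ((p i : ℚ) : ℝ) = p i • (1 : ℝ) := by rw [Rat.smul_def, mul_one]
    have h2 : ∀ j, ((M i j : ℚ) : ℝ) * x j = M i j • x j := fun j => by rw [Rat.smul_def]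
    simp only [aff, h1, h2, map_add, map_sum, map_smul, hone, smul_eq_mul, mul_one]
  refine ⟨fun i => φ (x i), fun i => ⟨?_, ?_⟩, fun i => ?_⟩
  · exact hφ _ (Or.inl (Or.inl (Or.inl ⟨i, rfl⟩))) (hx.1 i)
  · have := hφ _ (Or.inl (Or.inl (Or.inr ⟨i, rfl⟩))) (sub_nonneg.2 (hx.2 i))
    simpa [hone] using this
  · have hi : min (aff p M i) (aff q N i) = x i := congrFun hfix i
    change φ (x i) = _
    rw [← haff, ← haff]
    rcases le_total (aff p M i) (aff q N i) with h | h
    · have := hφ _ (Or.inl (Or.inr ⟨i, rfl⟩)) (sub_nonneg.2 h)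
      rw [Pi.sub_apply, map_sub, sub_nonneg] at this
      rw [min_eq_left this, ← hi, min_eq_left h]
    · have := hφ _ (Or.inr ⟨i, rfl⟩) (sub_nonneg.2 h)
      rw [Pi.sub_apply, map_sub, sub_nonneg] at this
      rw [min_eq_right this, ← hi, min_eq_right h]

/-- Under the dedicated debtor property each bank either writes no CDS, or writes only CDSes on
one reference bank, which itself writes none. -/
theorem DedicatedCDSDebtor.exists_reference {n : ℕ} {e : Fin n → ℝ} {c : Fin n → Fin n → ℝ}
    {cds : Fin n → Fin n → Fin n → ℝ} (hded : DedicatedCDSDebtor c cds)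
    (hfs : IsFinSys e c cds) (hnd : NonDegenerate e c cds) (i : Fin n) :
    ∃ (δ : ℚ) (R : Fin n), (δ = 0 ∧ ∀ j R', cds i j R' = 0) ∨
      (δ = 1 ∧ (∀ j, c i j = 0) ∧ (∀ j R', R' ≠ R → cds i j R' = 0) ∧
        (∃ j, 0 < cds i j R) ∧ ∀ j R', cds R j R' = 0) := by
  obtain ⟨-, -, -, hcds, -⟩ := hfs
  by_cases h : ∃ j R, 0 < cds i j R
  · obtain ⟨j, R, hjR⟩ := h
    obtain ⟨h1, h2⟩ := hded i ⟨j, R, hjR⟩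
    refine ⟨1, R, Or.inr ⟨rfl, h1, fun j' R' hR' => ?_, ⟨j, hjR⟩, fun j' R' => ?_⟩⟩
    · by_contra h0
      exact hR' (h2 j' R' j R (lt_of_le_of_ne (hcds _ _ _) (Ne.symm h0)) hjR)
    · by_contra h0
      obtain ⟨k, hk⟩ := hnd.2 R ⟨i, j, hjR⟩
      exact hk.ne' ((hded R ⟨j', R', lt_of_le_of_ne (hcds _ _ _) (Ne.symm h0)⟩).1 k)
  · push Not at h
    exact ⟨0, i, Or.inl ⟨rfl, fun j R => le_antisymm (h j R) (hcds _ _ _)⟩⟩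

/-- Every non-degenerate financial system with rational data satisfying the dedicated
CDS debtor property has a rational clearing vector. -/
theorem dedicated_debtor_rational_clearing {n : ℕ} (e : Fin n → ℝ)
    (c : Fin n → Fin n → ℝ) (cds : Fin n → Fin n → Fin n → ℝ)
    (hfs : IsFinSys e c cds) (hnd : NonDegenerate e c cds)
    (he : ∀ i, ∃ q : ℚ, e i = q)
    (hc : ∀ i j, ∃ q : ℚ, c i j = q)
    (hcds : ∀ i j R, ∃ q : ℚ, cds i j R = q)
    (hded : DedicatedCDSDebtor c cds) :
    ∃ r : Fin n → ℝ, IsClearing e c cds r ∧ ∀ i, ∃ q : ℚ, r i = q := by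
  choose δ ρ hρ using fun i => hded.exists_reference hfs hnd i
  obtain ⟨he0, hc0, -, hcds0, -⟩ := hfs
  choose e' he' using he
  choose c' hc' using hc
  choose cds' hcds' using hcds
  let k' : Fin n → Fin n → ℚ := fun i j => c' i j + ∑ R, cds' i j R
  let k : Fin n → Fin n → ℝ := fun i j => c i j + ∑ R, cds i j R
  let K' : Fin n → ℚ := fun i => ∑ j, k' i j
  let K : Fin n → ℝ := fun i => ∑ j, k i j
  have hk' : ∀ i j, (k' i j : ℝ) = k i j := by
    intro i j
    simp only [k', k, hc', hcds']
    push_cast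
    rfl
  have hK' : ∀ i, (K' i : ℝ) = K i := by
    intro i
    simp only [K', K, ← hk']
    push_cast
    rfl
  have hk0 : ∀ i j, 0 ≤ k i j := fun i j =>
    add_nonneg (hc0 i j) (sum_nonneg fun R _ => hcds0 i j R)
  have hK0 : ∀ i, 0 ≤ K i := fun i => sum_nonneg fun j _ => hk0 i j
  -- cap on the payment ratio, and incoming payments
  let u : (Fin n → ℝ) → Fin n → ℝ := fun v i => 1 - δ i * v (ρ i)
  let A : (Fin n → ℝ) → Fin n → ℝ := fun v i => e i + ∑ j, v j * k j i
  have hu : ∀ v ∈ Set.Icc (0 : Fin n → ℝ) 1, ∀ i, 0 ≤ u v i ∧ u v i ≤ 1 := by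
    intro v hv i
    have h0 : 0 ≤ v (ρ i) := hv.1 _
    have h1 : v (ρ i) ≤ 1 := hv.2 _
    rcases hρ i with h | h <;> simp [u, h.1, h0, h1]
  have hA : ∀ v ∈ Set.Icc (0 : Fin n → ℝ) 1, ∀ i, 0 ≤ A v i := fun v hv i =>
    add_nonneg (he0 i) (sum_nonneg fun j _ => mul_nonneg (hv.1 j) (hk0 j i))
  let q : Fin n → ℚ := fun i => if K' i = 0 then 1 else e' i / K' i
  let M : Fin n → Fin n → ℚ := fun i j => if K' i = 0 then 0 else if j = ρ i then -δ i else 0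
  let N : Fin n → Fin n → ℚ := fun i j => if K' i = 0 then 0 else k' j i / K' i
  have heval0 : ∀ (v : Fin n → ℝ) i, K i = 0 → min ((1 : ℚ) + ∑ j, (M i j : ℝ) * v j)
      (q i + ∑ j, (N i j : ℝ) * v j) = 1 := by
    intro v i hi
    have hi' : K' i = 0 := by exact_mod_cast (hK' i).trans hi
    simp [M, q, N, hi']
  have heval : ∀ (v : Fin n → ℝ) i, K i ≠ 0 → min ((1 : ℚ) + ∑ j, (M i j : ℝ) * v j)
      (q i + ∑ j, (N i j : ℝ) * v j) = min (u v i) (A v i / K i) := by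
    intro v i hi
    have hi' : K' i ≠ 0 := fun h => hi (by rw [← hK', h, Rat.cast_zero])
    congr 1
    · simp only [M, if_neg hi', u]
      rw [sum_eq_single (ρ i) (fun j _ hj => by simp [hj]) (by simp)]
      simp
      ring
    · simp only [q, N, if_neg hi', A, add_div, sum_div]
      push_cast
      rw [hK', he']
      congr 1
      exact sum_congr rfl fun j _ => by rw [hk']; ring
  obtain ⟨w, hw, hfix⟩ := exists_rat_fixedPoint_min_affine (fun _ => 1) q M N (by
    intro v hv
    suffices h : ∀ i, 0 ≤ min ((1 : ℚ) + ∑ j, (M i j : ℝ) * v j)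
        (q i + ∑ j, (N i j : ℝ) * v j) ∧ min ((1 : ℚ) + ∑ j, (M i j : ℝ) * v j)
        (q i + ∑ j, (N i j : ℝ) * v j) ≤ 1 from ⟨fun i => (h i).1, fun i => (h i).2⟩
    intro i
    by_cases hi : K i = 0
    · rw [heval0 v i hi]
      exact ⟨zero_le_one, le_rfl⟩
    · rw [heval v i hi]
      exact ⟨le_min (hu v hv i).1 (div_nonneg (hA v hv i) (hK0 i)),
        (min_le_left _ _).trans (hu v hv i).2⟩)
  let x : Fin n → ℝ := fun i => w i
  have hx : x ∈ Set.Icc (0 : Fin n → ℝ) 1 :=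
    ⟨fun i => Rat.cast_nonneg.2 (hw i).1, fun i => by
      change ((w i : ℚ) : ℝ) ≤ 1
      exact_mod_cast (hw i).2⟩
  have hxfix : ∀ i, x i = min ((1 : ℚ) + ∑ j, (M i j : ℝ) * x j)
      (q i + ∑ j, (N i j : ℝ) * x j) := by
    intro i
    change ((w i : ℚ) : ℝ) = _
    rw [hfix i]
    push_cast
    rfl
  have hx1 : ∀ i, K i = 0 → x i = 1 := fun i hi => by rw [hxfix, heval0 x i hi]
  have hx2 : ∀ i, K i ≠ 0 → x i = min (u x i) (A x i / K i) := fun i hi => by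
    rw [hxfix, heval x i hi]
  let r : Fin n → ℝ := fun i => if u x i = 0 then 1 else x i / u x i
  have hrx : ∀ i, δ i = 0 → r i = x i := by
    intro i hi
    simp [r, u, hi]
  have hcds_pos : ∀ i, δ i = 1 → 0 < K i := by
    intro i hi
    rcases hρ i with h | ⟨-, -, -, ⟨j, hj⟩, -⟩
    · exact absurd (h.1.symm.trans hi) zero_ne_one
    · calc 0 < cds i j (ρ i) := hj
        _ ≤ ∑ R, cds i j R := single_le_sum (fun R _ => hcds0 i j R) (mem_univ _)
        _ ≤ k i j := le_add_of_nonneg_left (hc0 i j)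
        _ ≤ K i := single_le_sum (fun j _ => hk0 i j) (mem_univ j)
  have hδρ : ∀ i, δ i = 1 → r (ρ i) = x (ρ i) := by
    intro i hi
    rcases hρ i with h | ⟨-, -, -, -, h⟩
    · exact absurd (h.1.symm.trans hi) zero_ne_one
    · refine hrx _ ?_
      rcases hρ (ρ i) with h' | ⟨-, -, -, ⟨j, hj⟩, -⟩
      · exact h'.1
      · exact absurd (h j _) hj.ne'
  have hliab : ∀ i j, liab c cds r i j = u x i * k i j := by
    intro i j
    rcases hρ i with h | ⟨hδ, hci, hcdsi, -, -⟩
    · simp [liab, u, k, h.1, h.2]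
    · simp only [liab, k, u, hci, hδ]
      rw [sum_eq_single (ρ i) (fun R _ hR => by rw [hcdsi j R hR, mul_zero]) (by simp),
        sum_eq_single (ρ i) (fun R _ hR => hcdsi j R hR) (by simp), hδρ i hδ]
      simp
  have htot : ∀ i, totLiab c cds r i = u x i * K i := by
    intro i
    simp only [totLiab, hliab, K, mul_sum]
  have hxu : ∀ i, x i ≤ u x i := by
    intro i
    by_cases hi : K i = 0
    · rcases hρ i with h | h
      · simpa [u, h.1] using hx.2 i
      · exact absurd hi (hcds_pos i h.1).ne'
    · rw [hx2 i hi]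
      exact min_le_left _ _
  have hpay : ∀ i j, r i * liab c cds r i j = x i * k i j := by
    intro i j
    rw [hliab]
    by_cases h : u x i = 0
    · have : x i = 0 := le_antisymm (h ▸ hxu i) (hx.1 i)
      rw [h, this]
      ring
    · simp only [r, if_neg h]
      rw [← mul_assoc, div_mul_cancel₀ _ h]
  have hassets : ∀ i, assets e c cds r i = A x i := by
    intro i
    simp only [assets, hpay, A]
  refine ⟨r, ⟨fun i => ?_, fun i => ⟨fun hpos => ?_, fun hzero => ?_⟩⟩, fun i => ?_⟩
  · by_cases h : u x i = 0
    · simp [r, h]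
    · simp only [r, if_neg h]
      exact ⟨div_nonneg (hx.1 i) (hu x hx i).1, div_le_one_of_le₀ (hxu i) (hu x hx i).1⟩
  · rw [htot] at hpos
    have hK : K i ≠ 0 := right_ne_zero_of_mul hpos.ne'
    have hui : u x i ≠ 0 := left_ne_zero_of_mul hpos.ne'
    rw [htot, hassets]
    simp only [r, if_neg hui]
    rw [hx2 i hK, ← min_div_div_right (hu x hx i).1, div_self hui, div_div, mul_comm (K i)]
  · rw [htot] at hzero
    rcases mul_eq_zero.1 hzero with h | h
    · simp [r, h]
    · rcases hρ i with h' | h'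
      · rw [hrx i h'.1, hx1 i h]
      · exact absurd h (hcds_pos i h'.1).ne'
  · by_cases h : u x i = 0
    · exact ⟨1, by simp [r, h]⟩
    · exact ⟨w i / (1 - δ i * w (ρ i)), by simp [r, h, u, x]⟩
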